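/- Let G be a locally (soluble-by-finite) group with the property K̄. Then the commutator subgroup ⁅G,G⁆ of G is periodic, i.e., every element of ⁅G,G⁆ has finite order. -/

import Mathlib

/-- A group `G` has property K̄ if for every subgroup `X` of `G` the set of
subgroups of the form `⁅X, H⁆`, with `H` ranging over subgroups of `G`, is finite. -/
def PropK (G : Type*) [Group G] : Prop :=
  ∀ X : Subgroup G, {S : Subgroup G | ∃ H : Subgroup G, S = ⁅X, H⁆}.Finite

/-- A group is locally (soluble-by-finite) if every finitely generated subgroup
contains a solvable subgroup of finite index. -/
def LocallySolubleByFinite (G : Type*) [Group G] : Prop :=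
  ∀ S : Subgroup G, S.FG → ∃ T : Subgroup S, IsSolvable T ∧ T.FiniteIndex

universe u

open scoped commutatorElement

theorem coe_finOrder {G : Type u} [Group G] {H : Subgroup G} {x : H} :
    IsOfFinOrder (x : G) ↔ IsOfFinOrder x :=
  Submonoid.isOfFinOrder_coe (H := H.toSubmonoid)

theorem PropK.subgroup {G : Type u} [Group G] (hG : PropK G) (S : Subgroup G) : PropK S := by
  intro X
  have h := hG (X.map S.subtype)
  refine Set.Finite.of_finite_image (f := Subgroup.map S.subtype) (h.subset ?_)
    (Subgroup.map_injective S.subtype_injective).injOn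
  rintro _ ⟨_, ⟨H, rfl⟩, rfl⟩
  exact ⟨H.map S.subtype, Subgroup.map_commutator _ _ _⟩

theorem PropK.quotient {G : Type u} [Group G] (hG : PropK G) (N : Subgroup G) [N.Normal] :
    PropK (G ⧸ N) := by
  intro X
  have h := (hG (X.comap (QuotientGroup.mk' N))).image (Subgroup.map (QuotientGroup.mk' N))
  refine h.subset ?_
  rintro _ ⟨H, rfl⟩
  refine ⟨_, ⟨H.comap (QuotientGroup.mk' N), rfl⟩, ?_⟩
  rw [Subgroup.map_commutator,
    Subgroup.map_comap_eq_self_of_surjective (QuotientGroup.mk'_surjective N),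
    Subgroup.map_comap_eq_self_of_surjective (QuotientGroup.mk'_surjective N)]

/-- Pigeonhole consequence of K̄. -/
theorem PropK.exists_pow {G : Type u} [Group G] (hG : PropK G) (x y : G) (n : ℕ) :
    ∃ i j : ℕ, i < j ∧ ⁅Subgroup.zpowers x, Subgroup.zpowers (y ^ n ^ i)⁆ =
      ⁅Subgroup.zpowers x, Subgroup.zpowers (y ^ n ^ j)⁆ := by
  obtain ⟨i, -, j, -, hij, h⟩ := Set.infinite_univ.exists_lt_map_eq_of_mapsTo
    (f := fun i : ℕ => ⁅Subgroup.zpowers x, Subgroup.zpowers (y ^ n ^ i)⁆)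
    (t := {S : Subgroup G | ∃ H : Subgroup G, S = ⁅Subgroup.zpowers x, H⁆})
    (fun i _ => ⟨_, rfl⟩) (hG _)
  exact ⟨i, j, hij, h⟩

theorem finiteType_toIntAlgebra {R : Type*} [CommRing R] [h : Algebra ℤ R]
    (H : Algebra.FiniteType ℤ R) : @Algebra.FiniteType ℤ R _ _ (Ring.toIntAlgebra R) := by
  rwa [Subsingleton.elim (Ring.toIntAlgebra R) h]

theorem int_isJacobsonRing : IsJacobsonRing ℤ := by
  rw [isJacobsonRing_iff_sInf_maximal']
  intro P hP
  by_cases h0 : P = ⊥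
  · refine ⟨{J | J.IsMaximal}, fun J hJ K hK => hJ.1.2 K hK, ?_⟩
    subst h0
    refine le_antisymm bot_le fun z hz => ?_
    rw [Ideal.mem_bot]
    obtain ⟨p, hp, hpp⟩ := Nat.exists_infinite_primes (z.natAbs + 1)
    have hprime : Prime (p : ℤ) := Nat.prime_iff_prime_int.mp hpp
    have hmax : (Ideal.span {(p : ℤ)}).IsMaximal :=
      PrincipalIdealRing.isMaximal_of_irreducible hprime.irreducible
    have hz' := (Ideal.mem_sInf.mp hz) hmax
    rw [Ideal.mem_span_singleton] at hz'
    by_contra hz0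
    have := Nat.le_of_dvd (Int.natAbs_pos.mpr hz0) (Int.natCast_dvd.mp hz')
    omega
  · have hmax := hP.isMaximal h0
    exact ⟨{P}, fun J hJ K hK => by rw [Set.mem_singleton_iff] at hJ; subst hJ; exact hmax.1.2 K hK,
      by simp⟩

/-- A cyclic module over a finitely generated commutative ring that is divisible is zero. -/
theorem eq_top_of_divisible {R : Type*} [CommRing R] [Algebra.FiniteType ℤ R] (I : Ideal R)
    (h : ∀ n : ℕ, 2 ≤ n → ∃ r : R, 1 - (n : R) * r ∈ I) : I = ⊤ := by
  by_contra hI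
  obtain ⟨m, hm, hIm⟩ := Ideal.exists_le_maximal I hI
  let _ : Field (R ⧸ m) := Ideal.Quotient.field m
  have := int_isJacobsonRing
  have hfin : Module.Finite ℤ (R ⧸ m) := finite_of_finite_type_of_isJacobsonRing ℤ (R ⧸ m)
  have hne : ∀ n : ℕ, 2 ≤ n → (n : R ⧸ m) ≠ 0 := by
    intro n hn h0
    obtain ⟨r, hr⟩ := h n hn
    have h1 := Ideal.Quotient.eq_zero_iff_mem.mpr (hIm hr)
    rw [map_sub, map_mul, map_natCast, h0, zero_mul, sub_zero, map_one] at h1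
    exact one_ne_zero h1
  have hinj : Function.Injective (algebraMap ℤ (R ⧸ m)) := by
    rw [injective_iff_map_eq_zero]
    intro z hz
    by_contra hz0
    apply hne (z.natAbs * 2) (by have := Int.natAbs_pos.mpr hz0; omega)
    have : ((z.natAbs : ℤ) : R ⧸ m) = 0 := by
      rcases Int.natAbs_eq z with h | h
      · rw [← h]; simpa using hz
      · rw [show (z.natAbs : ℤ) = -z by omega]; simpa using hz
    rw [Int.cast_natCast] at this
    rw [Nat.cast_mul, this, zero_mul]
  have hint : Algebra.IsIntegral ℤ (R ⧸ m) := inferInstance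
  exact Int.not_isField (isField_of_isIntegral_of_isField hinj (Field.toIsField (R ⧸ m)))

theorem unit_sub_one_dvd_zpow {R : Type*} [CommRing R] (u : Rˣ) (i : ℤ) :
    ((u : R) - 1) ∣ ((u ^ i : Rˣ) : R) - 1 := by
  have hn : ∀ n : ℕ, ((u : R) - 1) ∣ ((u ^ n : Rˣ) : R) - 1 := by
    intro n
    simpa using sub_dvd_pow_sub_pow (u : R) 1 n
  obtain ⟨n, rfl | rfl⟩ := i.eq_nat_or_neg
  · simpa using hn n
  · have : ((u ^ (-(n : ℤ)) : Rˣ) : R) - 1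
        = (((u ^ n : Rˣ) : R) - 1) * (-((u ^ n)⁻¹ : Rˣ)) := by
      rw [zpow_neg, zpow_natCast, sub_mul, mul_neg, Units.mul_inv]
      ring
    rw [this]
    exact (hn n).mul_right _

theorem central_of_torsionFree {G : Type u} [Group G] (hG : PropK G) (A : Subgroup G) [A.Normal]
    (hcomm : ∀ a ∈ A, ∀ b ∈ A, a * b = b * a)
    (htf : ∀ a ∈ A, IsOfFinOrder a → a = 1) : ∀ a ∈ A, ∀ t : G, ⁅t, a⁆ = 1 := by
  intro a ha t
  let _ : CommGroup A :=
    { (inferInstance : Group A) with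
      mul_comm := fun x y => Subtype.ext (hcomm x x.2 y y.2) }
  let F : G →* AddMonoid.End (Additive A) :=
    { toFun := fun g => MonoidHom.toAdditive (MulAut.conjNormal g : MulAut A).toMonoidHom
      map_one' := by
        refine AddMonoidHom.ext fun x => ?_
        change Additive.ofMul ((MulAut.conjNormal (1 : G) : MulAut A) x.toMul) = x
        rw [map_one]; rfl
      map_mul' := fun g h => by
        refine AddMonoidHom.ext fun x => ?_
        change Additive.ofMul ((MulAut.conjNormal (g * h) : MulAut A) x.toMul) = _
        rw [map_mul]; rfl }
  have hF : ∀ (g : G) (x : Additive A), ((F g x).toMul : G) = g * (x.toMul : G) * g⁻¹ := by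
    intro g x
    exact MulAut.conjNormal_apply g x.toMul
  let f : MonoidAlgebra ℤ (Multiplicative ℤ) →ₐ[ℤ] AddMonoid.End (Additive A) :=
    MonoidAlgebra.lift ℤ _ _ (F.comp (zpowersHom G t))
  have hfm : ∀ r s x, f (r * s) x = f r (f s x) := by
    intro r s x
    rw [map_mul]; rfl
  let u : (MonoidAlgebra ℤ (Multiplicative ℤ))ˣ :=
    Units.map (MonoidAlgebra.of ℤ (Multiplicative ℤ)) (toUnits (Multiplicative.ofAdd 1))
  have hu : ∀ i : ℤ, f (u ^ i : (MonoidAlgebra ℤ (Multiplicative ℤ))ˣ) = F (t ^ i) := by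
    intro i
    have h1 : ((u ^ i : (MonoidAlgebra ℤ (Multiplicative ℤ))ˣ) : MonoidAlgebra ℤ (Multiplicative ℤ))
        = MonoidAlgebra.of ℤ (Multiplicative ℤ) (Multiplicative.ofAdd i) := by
      rw [← map_zpow, Units.coe_map, ← map_zpow, ← ofAdd_zsmul]
      simp
    rw [h1]
    simp [f]
  let a' : Additive A := Additive.ofMul ⟨a, ha⟩
  let m : Additive A := f ((u : MonoidAlgebra ℤ (Multiplicative ℤ)) - 1) a'
  have hcom : ∀ (i : ℤ) (b : Additive A),
      ((f (((u ^ i : (MonoidAlgebra ℤ (Multiplicative ℤ))ˣ) : MonoidAlgebra ℤ (Multiplicative ℤ))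
        - 1) b).toMul : G) = ⁅t ^ i, (b.toMul : G)⁆ := by
    intro i b
    rw [map_sub, map_one, hu]
    change (((F (t ^ i) b).toMul / b.toMul : A) : G) = _
    rw [Subgroup.coe_div, hF, commutatorElement_def, div_eq_mul_inv]
  have hm : (m.toMul : G) = ⁅t, a⁆ := by
    have := hcom 1 a'
    rw [zpow_one, zpow_one] at this
    exact this
  suffices h : m = 0 by
    rw [← hm, h]; rfl
  have htf' : ∀ (n : ℕ) (b : Additive A), 0 < n → n • b = 0 → b = 0 := by
    intro n b hn hb
    have h1 : (b.toMul : G) ^ n = 1 := by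
      have := congrArg (fun x : Additive A => (x.toMul : G)) hb
      simpa using this
    have h2 := htf _ b.toMul.2 (isOfFinOrder_iff_pow_eq_one.mpr ⟨n, hn, h1⟩)
    exact Subtype.ext h2
  let L : ℕ → Subgroup G := fun k =>
    { carrier := {g | ∃ r, g = ((f ((k : MonoidAlgebra ℤ (Multiplicative ℤ)) * r) m).toMul : G)}
      one_mem' := ⟨0, by simp⟩
      mul_mem' := by
        rintro _ _ ⟨r, rfl⟩ ⟨s, rfl⟩
        refine ⟨r + s, ?_⟩
        rw [mul_add, map_add]; rfl
      inv_mem' := by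
        rintro _ ⟨r, rfl⟩
        refine ⟨-r, ?_⟩
        rw [mul_neg, map_neg]; rfl }
  have hL : ∀ k, ⁅Subgroup.zpowers t, Subgroup.zpowers (a ^ k)⁆ ≤ L k := by
    intro k
    rw [Subgroup.commutator_le]
    rintro _ ⟨i, rfl⟩ _ ⟨j, rfl⟩
    obtain ⟨s, hs⟩ := unit_sub_one_dvd_zpow u i
    refine ⟨(j : MonoidAlgebra ℤ (Multiplicative ℤ)) * s, ?_⟩
    have h1 := hcom i (j • (k • a'))
    have h2 : (((j • (k • a') : Additive A)).toMul : G) = (a ^ k) ^ j := by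
      simp [a']
    rw [h2] at h1
    change ⁅t ^ i, (a ^ k) ^ j⁆ = _
    rw [← h1]
    congr 2
    rw [hs, map_zsmul, map_nsmul]
    change _ = f _ (f _ a')
    rw [← hfm]
    have h3 : ((k : MonoidAlgebra ℤ (Multiplicative ℤ)) * (j * s)) * ((u : MonoidAlgebra ℤ (Multiplicative ℤ)) - 1)
      = j • (k • (((u : MonoidAlgebra ℤ (Multiplicative ℤ)) - 1) * s)) := by
      rw [zsmul_eq_mul, nsmul_eq_mul]; ring
    rw [h3, map_zsmul, map_nsmul]
    rfl
  have hmem : ∀ k : ℕ, ((k • m).toMul : G) ∈ ⁅Subgroup.zpowers t, Subgroup.zpowers (a ^ k)⁆ := by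
    intro k
    have h1 := hcom 1 (k • a')
    have h2 : ((k • m).toMul : G) = ⁅t, a ^ k⁆ := by
      rw [map_nsmul, zpow_one, zpow_one] at h1
      exact h1
    rw [h2]
    exact Subgroup.commutator_mem_commutator (Subgroup.mem_zpowers _) (Subgroup.mem_zpowers _)
  let I : Ideal (MonoidAlgebra ℤ (Multiplicative ℤ)) :=
    { carrier := {r | f r m = 0}
      zero_mem' := by simp
      add_mem' := by
        intro r s hr hs
        change f (r + s) m = 0
        rw [map_add]
        change f r m + f s m = 0
        rw [show f r m = 0 from hr, show f s m = 0 from hs, add_zero]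
      smul_mem' := by
        intro c r hr
        change f (c * r) m = 0
        rw [map_mul]
        change f c (f r m) = 0
        rw [show f r m = 0 from hr, map_zero] }
  have hI : I = ⊤ := by
    have : AddMonoid.FG ℤ := AddMonoid.fg_of_addGroup_fg
    have h0 : Algebra.FiniteType ℤ (MonoidAlgebra ℤ (Multiplicative ℤ)) :=
      MonoidAlgebra.finiteType_of_fg
    have := finiteType_toIntAlgebra h0
    apply eq_top_of_divisible
    intro n hn
    obtain ⟨i, j, hij, h⟩ := hG.exists_pow t a n
    have h1 := hmem (n ^ i)
    rw [h] at h1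
    obtain ⟨r, hr⟩ := hL _ h1
    have hr' : n ^ i • m = f (((n ^ j : ℕ) : MonoidAlgebra ℤ (Multiplicative ℤ)) * r) m :=
      Subtype.ext hr
    refine ⟨((n ^ (j - i - 1) : ℕ) : MonoidAlgebra ℤ (Multiplicative ℤ)) * r, ?_⟩
    change f _ m = 0
    apply htf' (n ^ i) _ (by positivity)
    have h4 : n ^ j = n ^ i * (n * n ^ (j - i - 1)) := by
      rw [← pow_succ', ← pow_add]; congr 1; omega
    rw [map_sub, map_one]
    change n ^ i • (m - f _ m) = 0
    rw [smul_sub, hr', h4, sub_eq_zero, Nat.cast_mul (n ^ i), mul_assoc, ← nsmul_eq_mul, map_nsmul,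
      Nat.cast_mul n, mul_assoc]
    rfl
  have h1 : (1 : MonoidAlgebra ℤ (Multiplicative ℤ)) ∈ I := by rw [hI]; trivial
  have h2 : f 1 m = 0 := h1
  rw [map_one] at h2
  exact h2

/-- A normal subgroup with periodic derived subgroup is central modulo periodic. -/
theorem exists_periodic {G : Type u} [Group G] (hG : PropK G) (N : Subgroup G) [N.Normal]
    (hN : ∀ g ∈ ⁅N, N⁆, IsOfFinOrder g) :
    ∃ T : Subgroup G, T.Normal ∧ (∀ g ∈ T, IsOfFinOrder g) ∧ ∀ x ∈ N, ∀ g : G, ⁅g, x⁆ ∈ T := by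
  have hN' : ∀ g ∈ commutator N, IsOfFinOrder g := by
    intro g hg
    rw [← coe_finOrder]
    apply hN
    rw [← Subgroup.map_subtype_commutator]
    exact ⟨g, hg, rfl⟩
  let T : Subgroup G :=
    { carrier := {x | x ∈ N ∧ IsOfFinOrder x}
      one_mem' := ⟨N.one_mem, IsOfFinOrder.one⟩
      inv_mem' := fun h => ⟨N.inv_mem h.1, h.2.inv⟩
      mul_mem' := by
        rintro x y ⟨hx, hx'⟩ ⟨hy, hy'⟩
        refine ⟨N.mul_mem hx hy, ?_⟩
        have h1 : IsOfFinOrder (⟨x, hx⟩ : N) := coe_finOrder.mp hx'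
        have h2 : IsOfFinOrder (⟨y, hy⟩ : N) := coe_finOrder.mp hy'
        have h3 := ((Abelianization.of : N →* _).isOfFinOrder h1).mul
          ((Abelianization.of : N →* _).isOfFinOrder h2)
        rw [← map_mul] at h3
        obtain ⟨n, hn, h4⟩ := isOfFinOrder_iff_pow_eq_one.mp h3
        rw [← map_pow, ← MonoidHom.mem_ker, Abelianization.ker_of] at h4
        exact (hN _ (by
          rw [← Subgroup.map_subtype_commutator]
          exact ⟨_, h4, rfl⟩) : IsOfFinOrder ((x * y) ^ n)).of_pow hn.ne' }
  have hT : T.Normal := ⟨fun x hx g => ⟨Subgroup.Normal.conj_mem inferInstance x hx.1 g, by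
    have := (MulAut.conj g).toMonoidHom.isOfFinOrder hx.2
    simpa using this⟩⟩
  refine ⟨T, hT, fun g hg => hg.2, ?_⟩
  intro x hx g
  have hnorm : (N.map (QuotientGroup.mk' T)).Normal :=
    Subgroup.Normal.map inferInstance _ (QuotientGroup.mk'_surjective T)
  have key := central_of_torsionFree (hG.quotient T) (N.map (QuotientGroup.mk' T)) ?_ ?_
    (QuotientGroup.mk' T x) ⟨x, hx, rfl⟩ (QuotientGroup.mk' T g)
  · rw [← map_commutatorElement] at key
    exact (QuotientGroup.eq_one_iff _).mp key
  · rintro _ ⟨b, hb, rfl⟩ _ ⟨c, hc, rfl⟩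
    rw [← commutatorElement_eq_one_iff_mul_comm, ← map_commutatorElement]
    refine (QuotientGroup.eq_one_iff _).mpr ⟨?_, hN _ (Subgroup.commutator_mem_commutator hb hc)⟩
    exact Subgroup.commutator_le_left N N (Subgroup.commutator_mem_commutator hb hc)
  · rintro _ ⟨b, hb, rfl⟩ hfin
    obtain ⟨n, hn, h4⟩ := isOfFinOrder_iff_pow_eq_one.mp hfin
    rw [← map_pow] at h4
    have h5 : b ^ n ∈ T := (QuotientGroup.eq_one_iff _).mp h4
    exact (QuotientGroup.eq_one_iff _).mpr ⟨hb, h5.2.of_pow hn.ne'⟩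

theorem periodic_of_quotient {G : Type u} [Group G] (T : Subgroup G) [T.Normal]
    (hT : ∀ g ∈ T, IsOfFinOrder g) (h : ∀ g ∈ commutator (G ⧸ T), IsOfFinOrder g) :
    ∀ g ∈ commutator G, IsOfFinOrder g := by
  intro g hg
  have h1 : QuotientGroup.mk' T g ∈ commutator (G ⧸ T) := by
    have h2 : (commutator G).map (QuotientGroup.mk' T) ≤ commutator (G ⧸ T) := by
      rw [commutator_def, commutator_def, Subgroup.map_commutator]
      exact Subgroup.commutator_mono le_top le_top
    exact h2 ⟨g, hg, rfl⟩
  obtain ⟨n, hn, h4⟩ := isOfFinOrder_iff_pow_eq_one.mp (h _ h1)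
  rw [← map_pow] at h4
  exact (hT _ ((QuotientGroup.eq_one_iff _).mp h4)).of_pow hn.ne'

theorem class_two {G : Type u} [Group G] (hG : PropK G)
    (hc : ∀ x y z : G, ⁅z, ⁅x, y⁆⁆ = 1) : ∀ g ∈ commutator G, IsOfFinOrder g := by
  have hc' : ∀ x y z : G, Commute ⁅x, y⁆ z := fun x y z =>
    (commutatorElement_eq_one_iff_mul_comm.mp (hc x y z)).symm
  have hmulr : ∀ x y z : G, ⁅x, y * z⁆ = ⁅x, y⁆ * ⁅x, z⁆ := by
    intro x y z
    have h := (hc' x z y).eq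
    calc ⁅x, y * z⁆ = ⁅x, y⁆ * (y * ⁅x, z⁆ * y⁻¹) := by
          simp only [commutatorElement_def]; group
      _ = _ := by rw [← h]; group
  have hmull : ∀ x y z : G, ⁅x * y, z⁆ = ⁅x, z⁆ * ⁅y, z⁆ := by
    intro x y z
    rw [← inv_inj, commutatorElement_inv, hmulr, mul_inv_rev, commutatorElement_inv,
      commutatorElement_inv]
    exact (hc' _ _ _).eq
  let fr : G → (G →* G) := fun x => MonoidHom.mk' (fun y => ⁅x, y⁆) (hmulr x)
  let fl : G → (G →* G) := fun y => MonoidHom.mk' (fun x => ⁅x, y⁆) (fun a b => hmull a b y)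
  have hr : ∀ (x y : G) (n : ℤ), ⁅x, y ^ n⁆ = ⁅x, y⁆ ^ n := fun x y n => map_zpow (fr x) y n
  have hl : ∀ (x y : G) (n : ℤ), ⁅x ^ n, y⁆ = ⁅x, y⁆ ^ n := fun x y n => map_zpow (fl y) x n
  have hxy : ∀ x y : G, IsOfFinOrder ⁅x, y⁆ := by
    intro x y
    obtain ⟨i, j, hij, h⟩ := hG.exists_pow x y 2
    have h1 : ⁅x, y⁆ ^ ((2 : ℤ) ^ i) ∈ ⁅Subgroup.zpowers x, Subgroup.zpowers (y ^ 2 ^ i)⁆ := by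
      rw [← hr]
      refine Subgroup.commutator_mem_commutator (Subgroup.mem_zpowers _) ?_
      rw [show y ^ ((2 : ℤ) ^ i) = y ^ 2 ^ i by
        rw [← zpow_natCast]; push_cast; rfl]
      exact Subgroup.mem_zpowers _
    have h2 : ⁅Subgroup.zpowers x, Subgroup.zpowers (y ^ 2 ^ j)⁆ ≤
        Subgroup.zpowers (⁅x, y⁆ ^ ((2 : ℤ) ^ j)) := by
      rw [Subgroup.commutator_le]
      rintro _ ⟨k, rfl⟩ _ ⟨l, rfl⟩
      refine ⟨k * l, ?_⟩
      change (⁅x, y⁆ ^ ((2 : ℤ) ^ j)) ^ (k * l) = ⁅x ^ k, (y ^ 2 ^ j) ^ l⁆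
      rw [hr, hl, ← zpow_natCast y, hr, ← zpow_mul, ← zpow_mul, ← zpow_mul]
      push_cast
      congr 1
    rw [h] at h1
    obtain ⟨k, hk⟩ := h2 h1
    rw [isOfFinOrder_iff_zpow_eq_one]
    refine ⟨2 ^ j * k - 2 ^ i, ?_, ?_⟩
    · intro h0
      have h3 : (2 : ℤ) ^ j = 2 ^ i * (2 * 2 ^ (j - i - 1)) := by
        rw [← pow_succ', ← pow_add]; congr 1; omega
      rw [h3, show (2 : ℤ) ^ i * (2 * 2 ^ (j - i - 1)) * k - 2 ^ i =
        2 ^ i * (2 * (2 ^ (j - i - 1) * k) - 1) by ring] at h0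
      rcases mul_eq_zero.mp h0 with h4 | h4
      · exact absurd h4 (by positivity)
      · omega
    · rw [zpow_sub, zpow_mul, ← hk]
      simp
  intro g hg
  rw [commutator_eq_closure] at hg
  have : IsOfFinOrder g ∧ ∀ z, Commute g z := by
    induction hg using Subgroup.closure_induction with
    | mem x hx =>
      obtain ⟨a, b, rfl⟩ := hx
      exact ⟨hxy a b, hc' a b⟩
    | one => exact ⟨IsOfFinOrder.one, Commute.one_left⟩
    | mul x y _ _ hx hy =>
      exact ⟨(hx.2 y).isOfFinOrder_mul hx.1 hy.1, fun z => (hx.2 z).mul_left (hy.2 z)⟩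
    | inv x _ hx => exact ⟨hx.1.inv, fun z => (hx.2 z).inv_left⟩
  exact this.1

theorem soluble_case (n : ℕ) : ∀ (G : Type u) [Group G], PropK G → derivedSeries G n = ⊥ →
    ∀ g ∈ commutator G, IsOfFinOrder g := by
  induction n with
  | zero =>
    intro G _ _ h g _
    have : g ∈ (⊤ : Subgroup G) := trivial
    rw [← derivedSeries_zero, h, Subgroup.mem_bot] at this
    rw [this]
    exact IsOfFinOrder.one
  | succ n ih =>
    intro G _ hG h
    have hd : ∀ k, (derivedSeries (commutator G) k).map (commutator G).subtype
        ≤ derivedSeries G (k + 1) := by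
      intro k
      induction k with
      | zero => 
        rw [derivedSeries_one]
        exact Subgroup.map_subtype_le _
      | succ k ihk =>
        rw [derivedSeries_succ, derivedSeries_succ _ (k + 1), Subgroup.map_commutator]
        exact Subgroup.commutator_mono ihk ihk
    have hd' : derivedSeries (commutator G) n = ⊥ := by
      have := hd n
      rw [h, le_bot_iff] at this
      exact (Subgroup.map_eq_bot_iff_of_injective _ (commutator G).subtype_injective).mp this
    have hper := ih (commutator G) (hG.subgroup _) hd'
    obtain ⟨T, hT, hTp, hTc⟩ := exists_periodic hG (commutator G) (by
      intro g hg
      rw [← Subgroup.map_subtype_commutator] at hg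
      obtain ⟨g, hg, rfl⟩ := hg
      exact coe_finOrder.mpr (hper g hg))
    apply periodic_of_quotient T hTp
    apply class_two (hG.quotient T)
    intro x y z
    obtain ⟨x, rfl⟩ := QuotientGroup.mk'_surjective T x
    obtain ⟨y, rfl⟩ := QuotientGroup.mk'_surjective T y
    obtain ⟨z, rfl⟩ := QuotientGroup.mk'_surjective T z
    rw [← map_commutatorElement, ← map_commutatorElement]
    exact (QuotientGroup.eq_one_iff _).mpr
      (hTc _ (Subgroup.commutator_mem_commutator trivial trivial) z)

theorem soluble_by_finite_case (G : Type u) [Group G] (hG : PropK G) (S : Subgroup G) [S.Normal]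
    [S.FiniteIndex] [hS : Group.IsSolvable S] : ∀ g ∈ commutator G, IsOfFinOrder g := by
  obtain ⟨n, hn⟩ := (Group.isSolvable_def S).mp hS
  have hper := soluble_case n S (hG.subgroup S) hn
  obtain ⟨T, hT, hTp, hTc⟩ := exists_periodic hG S (by
    intro g hg
    rw [← Subgroup.map_subtype_commutator] at hg
    obtain ⟨g, hg, rfl⟩ := hg
    exact coe_finOrder.mpr (hper g hg))
  apply periodic_of_quotient T hTp
  have hle : S ≤ (Subgroup.center (G ⧸ T)).comap (QuotientGroup.mk' T) := by
    intro x hx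
    rw [Subgroup.mem_comap, Subgroup.mem_center_iff]
    intro g
    obtain ⟨g, rfl⟩ := QuotientGroup.mk'_surjective T g
    rw [← commutatorElement_eq_one_iff_mul_comm, ← map_commutatorElement]
    exact (QuotientGroup.eq_one_iff _).mpr (hTc x hx g)
  have hfi : (Subgroup.center (G ⧸ T)).FiniteIndex := by
    have h1 := Subgroup.finiteIndex_of_le hle
    have h2 := h1.index_ne_zero
    rw [Subgroup.index_comap_of_surjective _ (QuotientGroup.mk'_surjective T)] at h2
    exact ⟨h2⟩
  intro g hg
  have h0 : commutator (G ⧸ T) ≤ (MonoidHom.transferCenterPow (G ⧸ T)).ker := by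
    rw [commutator_def, Subgroup.commutator_le]
    intro a _ b _
    rw [MonoidHom.mem_ker, map_commutatorElement, commutatorElement_eq_one_iff_mul_comm]
    exact Subtype.ext (Subgroup.mem_center_iff.mp (MonoidHom.transferCenterPow (G ⧸ T) b).2 _)
  have h1 := h0 hg
  rw [MonoidHom.mem_ker] at h1
  have h2 := congrArg Subtype.val h1
  rw [MonoidHom.transferCenterPow_apply] at h2
  exact isOfFinOrder_iff_pow_eq_one.mpr ⟨_, Nat.pos_of_ne_zero hfi.index_ne_zero, h2⟩

theorem exists_fg_commutator {G : Type u} [Group G] (g : G) (hg : g ∈ commutator G) :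
    ∃ S : Subgroup G, S.FG ∧ g ∈ ⁅S, S⁆ := by
  rw [commutator_eq_closure] at hg
  induction hg using Subgroup.closure_induction with
  | mem x hx =>
    classical
    obtain ⟨a, b, rfl⟩ := hx
    refine ⟨Subgroup.closure {a, b}, ⟨{a, b}, by simp⟩, ?_⟩
    exact Subgroup.commutator_mem_commutator (Subgroup.subset_closure (by simp))
      (Subgroup.subset_closure (by simp))
  | one => exact ⟨⊥, Subgroup.FG.bot, Subgroup.one_mem _⟩
  | mul x y _ _ hx hy =>
    obtain ⟨S, hS, hxS⟩ := hx
    obtain ⟨S', hS', hyS⟩ := hy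
    exact ⟨S ⊔ S', hS.sup hS', Subgroup.mul_mem _
      (Subgroup.commutator_mono le_sup_left le_sup_left hxS)
      (Subgroup.commutator_mono le_sup_right le_sup_right hyS)⟩
  | inv x _ hx =>
    obtain ⟨S, hS, hxS⟩ := hx
    exact ⟨S, hS, Subgroup.inv_mem _ hxS⟩

theorem stmt_5 (G : Type*) [Group G] (hloc : LocallySolubleByFinite G)
    (hG : PropK G) : ∀ g ∈ commutator G, IsOfFinOrder g := by
  intro g hg
  obtain ⟨S, hS, hgS⟩ := exists_fg_commutator g hg
  obtain ⟨T, hT, hTf⟩ := hloc S hS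
  have hT' : Group.IsSolvable T := hT
  have hsol : Group.IsSolvable T.normalCore :=
    Group.isSolvable_of_isSolvable_injective (Subgroup.inclusion_injective T.normalCore_le)
  rw [← Subgroup.map_subtype_commutator] at hgS
  obtain ⟨g', hg', rfl⟩ := hgS
  exact coe_finOrder.mpr
    (soluble_by_finite_case S (hG.subgroup S) T.normalCore g' hg')
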